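/- List-decoding direct product theorem: there exist universal constants c ∈ (1/2, 1) and c' > 0 such that for every (possibly partial) function f : X → {0,1} with X ⊆ {0,1}^m, every integer n ≥ 1, every ℓ ∈ {1, 2, …, n}, and every γ ∈ [c, 1), the worst-case randomized query complexity of the list-decoding task satisfies R_{γ^ℓ}(LD_ℓ^n ∘ f) ≥ c'·ℓ·R(f), where R(f) = R_{2/3}(f). -/

import Mathlib

open Finset

/-- Deterministic decision trees querying coordinates `i : ι` of inputs `x : ι → Bool`,
with leaves labelled by elements of `L`. -/
inductive DTree (ι : Type) (L : Type) : Type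
  | leaf (lab : L) : DTree ι L
  | node (i : ι) (t0 : DTree ι L) (t1 : DTree ι L) : DTree ι L

namespace DTree

variable {ι L : Type}

/-- Output label at the leaf reached by input `x`. -/
def out : DTree ι L → (ι → Bool) → L
  | .leaf lab, _ => lab
  | .node i t0 t1, x => if x i then out t1 x else out t0 x

/-- Number of queries made on input `x` (depth of the leaf reached by `x`). -/
def cost : DTree ι L → (ι → Bool) → ℕ
  | .leaf _, _ => 0
  | .node i t0 t1, x => (if x i then cost t1 x else cost t0 x) + 1

/-- Maximum leaf depth of the tree. -/
def depth : DTree ι L → ℕ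
  | .leaf _ => 0
  | .node _ t0 t1 => max (depth t0) (depth t1) + 1

/-- The set of inputs reaching the same leaf as input `x`. -/
def leafSet : DTree ι L → (ι → Bool) → Set (ι → Bool)
  | .leaf _, _ => Set.univ
  | .node i t0 t1, x => {y | y i = x i} ∩ (if x i then leafSet t1 x else leafSet t0 x)

/-- Every leaf label of the tree satisfies the predicate `P`. -/
def allLabels : DTree ι L → (L → Prop) → Prop
  | .leaf lab, P => P lab
  | .node _ t0 t1, P => allLabels t0 P ∧ allLabels t1 P

end DTree

/-- A randomized query algorithm: a finitely supported probability distribution over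
deterministic decision trees. -/
structure RandAlg (ι : Type) (L : Type) where
  k : ℕ
  p : Fin k → ℝ
  T : Fin k → DTree ι L
  p_nonneg : ∀ j, 0 ≤ p j
  p_sum : ∑ j, p j = 1

/-- A probability distribution on inputs, supported inside the domain `X`. -/
structure InputDist (ι : Type) [Fintype ι] [DecidableEq ι] (X : Set (ι → Bool)) where
  μ : (ι → Bool) → ℝ
  nonneg : ∀ x, 0 ≤ μ x
  sum_one : ∑ x, μ x = 1
  supp : ∀ x, x ∉ X → μ x = 0

/-- A score function `φ : [0,1] → [1/2,1]`. -/
structure ScoreFun where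
  φ : ℝ → ℝ
  continuous : ContinuousOn φ (Set.Icc 0 1)
  half_le : ∀ p ∈ Set.Icc (0:ℝ) 1, 1 / 2 ≤ φ p
  le_one : ∀ p ∈ Set.Icc (0:ℝ) 1, φ p ≤ 1
  map_zero : φ 0 = 1
  map_one : φ 1 = 1
  map_half : φ (1 / 2) = 1 / 2
  symm : ∀ p ∈ Set.Icc (0:ℝ) 1, φ (1 - p) = φ p
  mono : MonotoneOn φ (Set.Icc (1 / 2) 1)

section Defs

variable {ι L : Type} [Fintype ι] [DecidableEq ι]

/-- Mass of a set of inputs under the weight function `μ`. -/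
noncomputable def mass (μ : (ι → Bool) → ℝ) (S : Set (ι → Bool)) : ℝ :=
  ∑ x, Set.indicator S μ x

/-- Score `φ(μ(ℓ₁)/μ(ℓ))` of the leaf `ℓ` reached by `x` in the tree `t`. -/
noncomputable def leafScore (S : ScoreFun) (f : (ι → Bool) → Bool) (μ : (ι → Bool) → ℝ)
    (t : DTree ι L) (x : ι → Bool) : ℝ :=
  S.φ (mass μ (t.leafSet x ∩ {y | f y = true}) / mass μ (t.leafSet x))

/-- Score of a randomized algorithm: `E_{D∼R, x∼μ}[score(D(x))]`. -/
noncomputable def algScore (S : ScoreFun) (f : (ι → Bool) → Bool) (μ : (ι → Bool) → ℝ)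
    (R : RandAlg ι L) : ℝ :=
  ∑ j, R.p j * ∑ x, μ x * leafScore S f μ (R.T j) x

/-- Expected cost `E_{D∼R, x∼μ}[cost(D(x))]`. -/
noncomputable def expCost (μ : (ι → Bool) → ℝ) (R : RandAlg ι L) : ℝ :=
  ∑ j, R.p j * ∑ x, μ x * ((R.T j).cost x : ℝ)

/-- Score-weighted cost `E[score(D(x))·cost(D(x))] / E[score(D(x))]`. -/
noncomputable def scost (S : ScoreFun) (f : (ι → Bool) → Bool) (μ : (ι → Bool) → ℝ)
    (R : RandAlg ι L) : ℝ :=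
  (∑ j, R.p j * ∑ x, μ x * (leafScore S f μ (R.T j) x * ((R.T j).cost x : ℝ))) /
    algScore S f μ R

/-- Discounted score `E[score(D(x))·e^{-α·cost(D(x))}]`. -/
noncomputable def dScore (S : ScoreFun) (f : (ι → Bool) → Bool) (μ : (ι → Bool) → ℝ)
    (α : ℝ) (R : RandAlg ι L) : ℝ :=
  ∑ j, R.p j * ∑ x, μ x *
    (leafScore S f μ (R.T j) x * Real.exp (-(α * ((R.T j).cost x : ℝ))))

/-- Maximum discounted score `DS_α^μ(f)`. -/
noncomputable def DS (S : ScoreFun) (f : (ι → Bool) → Bool) (μ : (ι → Bool) → ℝ)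
    (α : ℝ) : ℝ :=
  ⨆ R : RandAlg ι Unit, dScore S f μ α R

/-- Distributional score-weighted query complexity `sR̄̄_γ^μ(f)`. -/
noncomputable def sRdist (S : ScoreFun) (f : (ι → Bool) → Bool) (μ : (ι → Bool) → ℝ)
    (γ : ℝ) : ℝ :=
  sInf {c | ∃ R : RandAlg ι Unit, γ ≤ algScore S f μ R ∧ scost S f μ R = c}

/-- Distributional query complexity `R̄̄_γ^μ(f)` (expected cost). -/
noncomputable def Rdist (S : ScoreFun) (f : (ι → Bool) → Bool) (μ : (ι → Bool) → ℝ)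
    (γ : ℝ) : ℝ :=
  sInf {c | ∃ R : RandAlg ι Unit, γ ≤ algScore S f μ R ∧ expCost μ R = c}

/-- Maximum score-weighted distributional query complexity `sR̄̄_γ(f)`. -/
noncomputable def sRmax (S : ScoreFun) (X : Set (ι → Bool)) (f : (ι → Bool) → Bool)
    (γ : ℝ) : ℝ :=
  ⨆ μ : InputDist ι X, sRdist S f μ.μ γ

/-- Maximum distributional query complexity `R̄̄_γ(f)`. -/
noncomputable def Rmax (S : ScoreFun) (X : Set (ι → Bool)) (f : (ι → Bool) → Bool)
    (γ : ℝ) : ℝ :=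
  ⨆ μ : InputDist ι X, Rdist S f μ.μ γ

/-- Success-probability score `max{μ(ℓ₀),μ(ℓ₁)}/μ(ℓ)` of the leaf reached by `x`. -/
noncomputable def succLeafScore (f : (ι → Bool) → Bool) (μ : (ι → Bool) → ℝ)
    (t : DTree ι L) (x : ι → Bool) : ℝ :=
  max (mass μ (t.leafSet x ∩ {y | f y = false})) (mass μ (t.leafSet x ∩ {y | f y = true})) /
    mass μ (t.leafSet x)

/-- Success-probability score of a randomized algorithm. -/
noncomputable def succAlgScore (f : (ι → Bool) → Bool) (μ : (ι → Bool) → ℝ)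
    (R : RandAlg ι L) : ℝ :=
  ∑ j, R.p j * ∑ x, μ x * succLeafScore f μ (R.T j) x

/-- Distributional query complexity with the success-probability score. -/
noncomputable def succRdist (f : (ι → Bool) → Bool) (μ : (ι → Bool) → ℝ) (γ : ℝ) : ℝ :=
  sInf {c | ∃ R : RandAlg ι Unit, γ ≤ succAlgScore f μ R ∧ expCost μ R = c}

/-- Maximum distributional query complexity `R̄̄_γ(f)` with the success-probability score. -/
noncomputable def succRmax (X : Set (ι → Bool)) (f : (ι → Bool) → Bool) (γ : ℝ) : ℝ :=
  ⨆ μ : InputDist ι X, succRdist f μ.μ γ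

/-- The fraction `q = μ(ℓ₁)/μ(ℓ)` at the leaf reached by `x`. -/
noncomputable def leafBias (f : (ι → Bool) → Bool) (μ : (ι → Bool) → ℝ)
    (t : DTree ι L) (x : ι → Bool) : ℝ :=
  mass μ (t.leafSet x ∩ {y | f y = true}) / mass μ (t.leafSet x)

/-- Hellinger loss `E[2·√(q(1-q))]` of a randomized algorithm. -/
noncomputable def helLossAlg (f : (ι → Bool) → Bool) (μ : (ι → Bool) → ℝ)
    (R : RandAlg ι L) : ℝ :=
  ∑ j, R.p j * ∑ x, μ x *
    (2 * Real.sqrt (leafBias f μ (R.T j) x * (1 - leafBias f μ (R.T j) x)))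

/-- Hellinger score `E[1 - √(q(1-q))]` of a randomized algorithm. -/
noncomputable def helScoreAlg (f : (ι → Bool) → Bool) (μ : (ι → Bool) → ℝ)
    (R : RandAlg ι L) : ℝ :=
  ∑ j, R.p j * ∑ x, μ x *
    (1 - Real.sqrt (leafBias f μ (R.T j) x * (1 - leafBias f μ (R.T j) x)))

/-- `R̄̄_{Hel↓,ε}(f)`: maximum distributional complexity at Hellinger loss `ε`. -/
noncomputable def RmaxHelLoss (X : Set (ι → Bool)) (f : (ι → Bool) → Bool) (ε : ℝ) : ℝ :=
  ⨆ μ : InputDist ι X,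
    sInf {c | ∃ R : RandAlg ι Unit, helLossAlg f μ.μ R ≤ ε ∧ expCost μ.μ R = c}

/-- `R̄̄_{Hel,γ}(f)`: maximum distributional complexity at Hellinger score `γ`. -/
noncomputable def RmaxHel (X : Set (ι → Bool)) (f : (ι → Bool) → Bool) (γ : ℝ) : ℝ :=
  ⨆ μ : InputDist ι X,
    sInf {c | ∃ R : RandAlg ι Unit, γ ≤ helScoreAlg f μ.μ R ∧ expCost μ.μ R = c}

/-- Binary entropy function. -/
noncomputable def binEnt (p : ℝ) : ℝ :=
  -(p * Real.logb 2 p) - (1 - p) * Real.logb 2 (1 - p)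

/-- Exponential-entropy score `E[1 - (1/2)·2^{-h(q)}]` of a randomized algorithm. -/
noncomputable def entScoreAlg (f : (ι → Bool) → Bool) (μ : (ι → Bool) → ℝ)
    (R : RandAlg ι L) : ℝ :=
  ∑ j, R.p j * ∑ x, μ x *
    (1 - (1 / 2) * (2:ℝ) ^ (-(binEnt (leafBias f μ (R.T j) x))))

/-- `R̄̄_{Ent,γ}(f)`: maximum distributional complexity at exponential-entropy score `γ`. -/
noncomputable def RmaxEnt (X : Set (ι → Bool)) (f : (ι → Bool) → Bool) (γ : ℝ) : ℝ :=
  ⨆ μ : InputDist ι X,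
    sInf {c | ∃ R : RandAlg ι Unit, γ ≤ entScoreAlg f μ.μ R ∧ expCost μ.μ R = c}

end Defs

section WorstCase

variable {ι L : Type}

open Classical in
/-- Worst-case randomized query complexity for a generic task: minimum, over randomized
algorithms whose leaf labels satisfy `labelOK` and which on every input `x ∈ X` output a
label `z` with `good x z` with probability at least `δ`, of the maximum leaf depth over
the trees in the support. -/
noncomputable def RwcTask (X : Set (ι → Bool)) (good : (ι → Bool) → L → Prop)
    (labelOK : L → Prop) (δ : ℝ) : ℕ :=
  sInf {d : ℕ | ∃ R : RandAlg ι L,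
    (∀ j, R.p j ≠ 0 → (R.T j).allLabels labelOK) ∧
    (∀ x ∈ X, δ ≤ ∑ j, if good x ((R.T j).out x) then R.p j else 0) ∧
    ∀ j, R.p j ≠ 0 → (R.T j).depth ≤ d}

/-- Worst-case randomized query complexity `R_δ(f)` of a (partial) Boolean function. -/
noncomputable def Rwc (X : Set (ι → Bool)) (f : (ι → Bool) → Bool) (δ : ℝ) : ℕ :=
  RwcTask X (fun x b => b = f x) (fun _ : Bool => True) δ

end WorstCase

section Product

variable {m n : ℕ} {L : Type}

/-- The `i`-th block of an input to the `n`-fold direct product. -/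
def block (x : Fin n × Fin m → Bool) (i : Fin n) : Fin m → Bool := fun j => x (i, j)

/-- The product domain `Xⁿ`. -/
def Xpow (n : ℕ) (X : Set (Fin m → Bool)) : Set (Fin n × Fin m → Bool) :=
  {x | ∀ i, block x i ∈ X}

/-- The `n`-fold direct product `fⁿ`. -/
def fpow (f : (Fin m → Bool) → Bool) (x : Fin n × Fin m → Bool) : Fin n → Bool :=
  fun i => f (block x i)

/-- The product distribution `μⁿ`. -/
noncomputable def prodMu (μ : (Fin m → Bool) → ℝ) (x : Fin n × Fin m → Bool) : ℝ :=
  ∏ i, μ (block x i)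

/-- The `i`-th factor `ℓ^(i)` of the (product) leaf reached by `x` in a decision tree for `fⁿ`. -/
def blockSet (t : DTree (Fin n × Fin m) L) (x : Fin n × Fin m → Bool) (i : Fin n) :
    Set (Fin m → Bool) :=
  {y | (fun q : Fin n × Fin m => if q.1 = i then y q.2 else x q) ∈ t.leafSet x}

/-- Score of a leaf of a tree for `fⁿ` under `μⁿ`: the product of the scores of its factors. -/
noncomputable def prodLeafScore (S : ScoreFun) (f : (Fin m → Bool) → Bool)
    (μ : (Fin m → Bool) → ℝ) (t : DTree (Fin n × Fin m) L) (x : Fin n × Fin m → Bool) : ℝ :=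
  ∏ i, S.φ (mass μ (blockSet t x i ∩ {y | f y = true}) / mass μ (blockSet t x i))

/-- Score of a randomized algorithm for `fⁿ` under `μⁿ`. -/
noncomputable def algScoreN (S : ScoreFun) (f : (Fin m → Bool) → Bool)
    (μ : (Fin m → Bool) → ℝ) (R : RandAlg (Fin n × Fin m) L) : ℝ :=
  ∑ j, R.p j * ∑ x, prodMu μ x * prodLeafScore S f μ (R.T j) x

/-- Score-weighted cost of a randomized algorithm for `fⁿ` under `μⁿ`. -/
noncomputable def scostN (S : ScoreFun) (f : (Fin m → Bool) → Bool)
    (μ : (Fin m → Bool) → ℝ) (R : RandAlg (Fin n × Fin m) L) : ℝ :=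
  (∑ j, R.p j * ∑ x, prodMu μ x * (prodLeafScore S f μ (R.T j) x * ((R.T j).cost x : ℝ))) /
    algScoreN S f μ R

/-- Discounted score of a randomized algorithm for `fⁿ` under `μⁿ`. -/
noncomputable def dScoreN (S : ScoreFun) (f : (Fin m → Bool) → Bool)
    (μ : (Fin m → Bool) → ℝ) (α : ℝ) (R : RandAlg (Fin n × Fin m) L) : ℝ :=
  ∑ j, R.p j * ∑ x, prodMu μ x *
    (prodLeafScore S f μ (R.T j) x * Real.exp (-(α * ((R.T j).cost x : ℝ))))

/-- Maximum discounted score `DS_α^{μⁿ}(fⁿ)`. -/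
noncomputable def DSN (S : ScoreFun) (f : (Fin m → Bool) → Bool)
    (μ : (Fin m → Bool) → ℝ) (α : ℝ) (n : ℕ) : ℝ :=
  ⨆ R : RandAlg (Fin n × Fin m) Unit, dScoreN S f μ α R

/-- Distributional score-weighted query complexity `sR̄̄_γ^{μⁿ}(fⁿ)`. -/
noncomputable def sRdistN (S : ScoreFun) (f : (Fin m → Bool) → Bool)
    (μ : (Fin m → Bool) → ℝ) (γ : ℝ) (n : ℕ) : ℝ :=
  sInf {c | ∃ R : RandAlg (Fin n × Fin m) Unit,
    γ ≤ algScoreN S f μ R ∧ scostN S f μ R = c}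

/-- Worst-case randomized query complexity `R_δ(fⁿ)` of computing `fⁿ` exactly. -/
noncomputable def RwcN (X : Set (Fin m → Bool)) (f : (Fin m → Bool) → Bool)
    (n : ℕ) (δ : ℝ) : ℕ :=
  RwcTask (Xpow n X) (fun x z => z = fpow f x) (fun _ : Fin n → Bool => True) δ

/-- Success-probability score `max_z μ(ℓ ∩ (fⁿ)⁻¹(z))/μ(ℓ)` of a leaf of a tree for `fⁿ`
under an arbitrary distribution `μ` on `Xⁿ`. -/
noncomputable def succLeafScoreN (f : (Fin m → Bool) → Bool)
    (μ : (Fin n × Fin m → Bool) → ℝ) (t : DTree (Fin n × Fin m) L)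
    (x : Fin n × Fin m → Bool) : ℝ :=
  (⨆ z : Fin n → Bool, mass μ (t.leafSet x ∩ {y | fpow f y = z})) / mass μ (t.leafSet x)

/-- Success-probability score of a randomized algorithm for `fⁿ`. -/
noncomputable def succAlgScoreN (f : (Fin m → Bool) → Bool)
    (μ : (Fin n × Fin m → Bool) → ℝ) (R : RandAlg (Fin n × Fin m) L) : ℝ :=
  ∑ j, R.p j * ∑ x, μ x * succLeafScoreN f μ (R.T j) x

/-- Score-weighted cost of a randomized algorithm for `fⁿ` (success-probability score). -/
noncomputable def succScostN (f : (Fin m → Bool) → Bool)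
    (μ : (Fin n × Fin m → Bool) → ℝ) (R : RandAlg (Fin n × Fin m) L) : ℝ :=
  (∑ j, R.p j * ∑ x, μ x * (succLeafScoreN f μ (R.T j) x * ((R.T j).cost x : ℝ))) /
    succAlgScoreN f μ R

/-- Maximum score-weighted distributional query complexity `sR̄̄_δ(fⁿ)`
(success-probability score). -/
noncomputable def succSRmaxN (X : Set (Fin m → Bool)) (f : (Fin m → Bool) → Bool)
    (n : ℕ) (δ : ℝ) : ℝ :=
  ⨆ μ : InputDist (Fin n × Fin m) (Xpow n X),
    sInf {c | ∃ R : RandAlg (Fin n × Fin m) Unit,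
      δ ≤ succAlgScoreN f μ.μ R ∧ succScostN f μ.μ R = c}

/-- Worst-case randomized query complexity of the list-decoding task `LD_ℓⁿ ∘ f`. -/
noncomputable def RwcLD (X : Set (Fin m → Bool)) (f : (Fin m → Bool) → Bool)
    (n ℓ : ℕ) (δ : ℝ) : ℕ :=
  RwcTask (Xpow n X) (fun x S => fpow f x ∈ S)
    (fun S : Finset (Fin n → Bool) => S.card = 2 ^ (n - ℓ)) δ

open Classical in
/-- Worst-case randomized query complexity of the threshold task `Thr_kⁿ ∘ f`. -/
noncomputable def RwcThr (X : Set (Fin m → Bool)) (f : (Fin m → Bool) → Bool)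
    (n k : ℕ) (δ : ℝ) : ℕ :=
  RwcTask (Xpow n X)
    (fun x z => k ≤ (Finset.univ.filter fun i => z i = fpow f x i).card)
    (fun _ : Fin n → Bool => True) δ

open Classical in
/-- Worst-case randomized query complexity of the labelled threshold task `Label_kⁿ ∘ f`. -/
noncomputable def RwcLabel (X : Set (Fin m → Bool)) (f : (Fin m → Bool) → Bool)
    (n k : ℕ) (δ : ℝ) : ℕ :=
  RwcTask (Xpow n X)
    (fun x z => ∀ i b, z i = some b → fpow f x i = b)
    (fun z : Fin n → Option Bool =>
      (Finset.univ.filter fun i => (z i).isSome).card = k) δ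

end Product

namespace DTree

variable {ι L L' : Type}

/-- Relabel the leaves of a tree. -/
def map (g : L → L') : DTree ι L → DTree ι L'
  | .leaf lab => .leaf (g lab)
  | .node i t0 t1 => .node i (map g t0) (map g t1)

lemma out_map (g : L → L') (t : DTree ι L) (x : ι → Bool) : (t.map g).out x = g (t.out x) := by
  induction t with
  | leaf => rfl
  | node i t0 t1 h0 h1 => simp only [map, out, h0, h1]; split <;> rfl

lemma depth_map (g : L → L') (t : DTree ι L) : (t.map g).depth = t.depth := by
  induction t with
  | leaf => rfl
  | node i t0 t1 h0 h1 => simp only [map, depth, h0, h1]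

lemma allLabels_true (t : DTree ι L) : t.allLabels (fun _ => True) := by
  induction t with
  | leaf => trivial
  | node i t0 t1 h0 h1 => exact ⟨h0, h1⟩

/-- Run `t`, then continue with a tree depending on the label of the leaf reached and on the
number of queries made, counted from `c`. -/
def graft (k : L → ℕ → DTree ι L') : DTree ι L → ℕ → DTree ι L'
  | .leaf lab, c => k lab c
  | .node i t0 t1, c => .node i (graft k t0 (c + 1)) (graft k t1 (c + 1))

lemma out_graft (k : L → ℕ → DTree ι L') (t : DTree ι L) (c : ℕ) (x : ι → Bool) :
    (t.graft k c).out x = (k (t.out x) (c + t.cost x)).out x := by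
  induction t generalizing c with
  | leaf => rfl
  | node i t0 t1 h0 h1 =>
    simp only [graft, out, cost, h0, h1]
    split
    · rw [add_right_comm, add_assoc]
    · rw [add_right_comm, add_assoc]

lemma depth_graft_le (k : L → ℕ → DTree ι L') (M : ℕ) (t : DTree ι L) (c : ℕ)
    (hk : ∀ lab e, e ≤ c + t.depth → e + (k lab e).depth ≤ M) :
    c + (t.graft k c).depth ≤ M := by
  induction t generalizing c with
  | leaf lab => exact hk lab c (by simp [depth])
  | node i t0 t1 h0 h1 =>
    have e0 := h0 (c + 1) fun lab e he => hk lab e (by simp only [depth]; omega)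
    have e1 := h1 (c + 1) fun lab e he => hk lab e (by simp only [depth]; omega)
    simp only [graft, depth]
    omega

/-- Every function of finitely many bits is computed by some decision tree. -/
lemma exists_out_eq [Fintype ι] [DecidableEq ι] (P : L → Prop) (g : (ι → Bool) → L)
    (hg : ∀ x, P (g x)) : ∃ t : DTree ι L, t.allLabels P ∧ ∀ x, t.out x = g x := by
  suffices H : ∀ (s : Finset ι) (g : (ι → Bool) → L), (∀ x, P (g x)) →
      (∀ x y, (∀ i ∈ s, x i = y i) → g x = g y) →
      ∃ t : DTree ι L, t.allLabels P ∧ ∀ x, t.out x = g x from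
    H univ g hg fun x y h => by rw [funext fun i => h i (mem_univ i)]
  intro s
  induction s using Finset.induction_on with
  | empty =>
    intro g hg hs
    exact ⟨.leaf (g fun _ => false), hg _, fun x => hs _ _ (by simp)⟩
  | insert i s hi ih =>
    intro g hg hs
    have key : ∀ b, ∃ t : DTree ι L, t.allLabels P ∧
        ∀ x, t.out x = g (Function.update x i b) := by
      intro b
      refine ih (fun x => g (Function.update x i b)) (fun x => hg _) fun x y h => hs _ _ ?_
      intro j hj
      by_cases hji : j = i
      · subst hji; simp
      · simp [Function.update_of_ne hji, h j ((mem_insert.1 hj).resolve_left hji)]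
    obtain ⟨t0, hp0, ht0⟩ := key false
    obtain ⟨t1, hp1, ht1⟩ := key true
    refine ⟨.node i t0 t1, ⟨hp0, hp1⟩, fun x => ?_⟩
    simp only [out, ht0, ht1]
    split
    · rename_i h; rw [← h, Function.update_eq_self]
    · rename_i h; rw [← Bool.eq_false_of_not_eq_true h, Function.update_eq_self]

end DTree

section Value

variable {ι : Type}

/-- The part of the weight `w` living on inputs with `x i = b`. -/
def bitWeight (w : (ι → Bool) → ℝ) (i : ι) (b : Bool) (x : ι → Bool) : ℝ :=
  if x i = b then w x else 0

lemma bitWeight_nonneg {w : (ι → Bool) → ℝ} (hw : ∀ x, 0 ≤ w x) (i : ι) (b : Bool)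
    (x : ι → Bool) : 0 ≤ bitWeight w i b x := by
  unfold bitWeight; split
  · exact hw x
  · exact le_rfl

variable [Fintype ι]

/-- The total weight of the inputs with `f x = b`. -/
def classMass [DecidableEq ι] (f : (ι → Bool) → Bool) (w : (ι → Bool) → ℝ) (b : Bool) : ℝ :=
  ∑ x, if f x = b then w x else 0

variable [DecidableEq ι] (f : (ι → Bool) → Bool)

lemma classMass_nonneg {w : (ι → Bool) → ℝ} (hw : ∀ x, 0 ≤ w x) (b : Bool) :
    0 ≤ classMass f w b :=
  sum_nonneg fun x _ => by split; exacts [hw x, le_rfl]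

lemma classMass_add (w : (ι → Bool) → ℝ) :
    classMass f w false + classMass f w true = ∑ x, w x := by
  rw [classMass, classMass, ← sum_add_distrib]
  exact sum_congr rfl fun x _ => by cases f x <;> simp

lemma sum_node (w : (ι → Bool) → ℝ) (i : ι) (g0 g1 : (ι → Bool) → ℝ) :
    ∑ x, w x * (if x i then g1 x else g0 x) =
      ∑ x, bitWeight w i false x * g0 x + ∑ x, bitWeight w i true x * g1 x := by
  rw [← sum_add_distrib]
  exact sum_congr rfl fun x _ => by unfold bitWeight; cases x i <;> simp

lemma sum_bitWeight (w : (ι → Bool) → ℝ) (i : ι) :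
    ∑ x, bitWeight w i false x + ∑ x, bitWeight w i true x = ∑ x, w x := by
  simpa using (sum_node w i (fun _ => 1) (fun _ => 1)).symm

/-- The (unnormalised) `ℓ²` score of a leaf. -/
noncomputable def leafVal (w : (ι → Bool) → ℝ) : ℝ :=
  √(2 * (classMass f w false ^ 2 + classMass f w true ^ 2))

/-- The expected discounted `ℓ²` score of a tree. -/
noncomputable def treeVal (α : ℝ) : DTree ι Unit → ((ι → Bool) → ℝ) → ℝ
  | .leaf _, w => leafVal f w
  | .node i t0 t1, w =>
      Real.exp (-α) * (treeVal α t0 (bitWeight w i false) + treeVal α t1 (bitWeight w i true))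

/-- The maximum discounted `ℓ²` score. -/
noncomputable def optVal (α : ℝ) (w : (ι → Bool) → ℝ) : ℝ := ⨆ t, treeVal f α t w

lemma leafVal_le {w : (ι → Bool) → ℝ} (hw : ∀ x, 0 ≤ w x) :
    leafVal f w ≤ √2 * ∑ x, w x := by
  have h0 := classMass_nonneg f hw false
  have h1 := classMass_nonneg f hw true
  rw [leafVal, Real.sqrt_mul (by norm_num), ← classMass_add f w]
  gcongr
  exact Real.sqrt_le_iff.2 ⟨by positivity, by nlinarith⟩

lemma treeVal_le {α : ℝ} (hα : 0 ≤ α) (t : DTree ι Unit) {w : (ι → Bool) → ℝ}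
    (hw : ∀ x, 0 ≤ w x) : treeVal f α t w ≤ √2 * ∑ x, w x := by
  induction t generalizing w with
  | leaf => exact leafVal_le f hw
  | node i t0 t1 h0 h1 =>
    have e0 := h0 (bitWeight_nonneg hw i false)
    have e1 := h1 (bitWeight_nonneg hw i true)
    have hs : 0 ≤ √2 * ∑ x, w x := mul_nonneg (Real.sqrt_nonneg _) (sum_nonneg fun x _ => hw x)
    have he : Real.exp (-α) ≤ 1 := Real.exp_le_one_iff.2 (by linarith)
    calc _ ≤ Real.exp (-α) * (√2 * ∑ x, w x) := by
            rw [treeVal, ← sum_bitWeight w i, mul_add √2]; gcongr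
      _ ≤ _ := mul_le_of_le_one_left hs he

lemma treeVal_node_le {α : ℝ} (hα : 0 ≤ α) (i : ι) (t0 t1 : DTree ι Unit)
    {w : (ι → Bool) → ℝ} (hw : ∀ x, 0 ≤ w x) :
    treeVal f α (.node i t0 t1) w ≤ Real.exp (-α) * (√2 * ∑ x, w x) := by
  rw [treeVal, ← sum_bitWeight w i, mul_add √2]
  gcongr
  · exact treeVal_le f hα t0 (bitWeight_nonneg hw i false)
  · exact treeVal_le f hα t1 (bitWeight_nonneg hw i true)

lemma bddAbove_treeVal {α : ℝ} (hα : 0 ≤ α) {w : (ι → Bool) → ℝ} (hw : ∀ x, 0 ≤ w x) :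
    BddAbove (Set.range fun t => treeVal f α t w) :=
  ⟨√2 * ∑ x, w x, by rintro _ ⟨t, rfl⟩; exact treeVal_le f hα t hw⟩

lemma leafVal_le_optVal {α : ℝ} (hα : 0 ≤ α) {w : (ι → Bool) → ℝ} (hw : ∀ x, 0 ≤ w x) :
    leafVal f w ≤ optVal f α w :=
  le_ciSup (bddAbove_treeVal f hα hw) (.leaf ())

lemma optVal_nonneg {α : ℝ} (hα : 0 ≤ α) {w : (ι → Bool) → ℝ} (hw : ∀ x, 0 ≤ w x) :
    0 ≤ optVal f α w :=
  (Real.sqrt_nonneg _).trans (leafVal_le_optVal f hα hw)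

lemma optVal_add_le {α : ℝ} (hα : 0 ≤ α) {w : (ι → Bool) → ℝ} (hw : ∀ x, 0 ≤ w x) (i : ι) :
    optVal f α (bitWeight w i false) + optVal f α (bitWeight w i true) ≤
      Real.exp α * optVal f α w := by
  have : Nonempty (DTree ι Unit) := ⟨.leaf ()⟩
  have key : ∀ t0 t1, treeVal f α t0 (bitWeight w i false) +
      treeVal f α t1 (bitWeight w i true) ≤ Real.exp α * optVal f α w := by
    intro t0 t1
    have h : treeVal f α (.node i t0 t1) w ≤ optVal f α w :=
      le_ciSup (bddAbove_treeVal f hα hw) _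
    calc _ = Real.exp α * treeVal f α (.node i t0 t1) w := by
            rw [treeVal, ← mul_assoc, ← Real.exp_add]; simp
      _ ≤ _ := mul_le_mul_of_nonneg_left h (Real.exp_nonneg _)
  rw [← le_sub_iff_add_le]
  refine ciSup_le fun t0 => ?_
  rw [le_sub_comm]
  exact ciSup_le fun t1 => by linarith [key t0 t1]

end Value

section DirectProduct

variable {m n : ℕ} (f : (Fin m → Bool) → Bool)

lemma sum_prod_block (w : Fin n → (Fin m → Bool) → ℝ) :
    ∑ x : Fin n × Fin m → Bool, ∏ i, w i (block x i) = ∏ i, ∑ y, w i y := by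
  rw [Fintype.prod_sum]
  exact Fintype.sum_equiv (Equiv.curry (Fin n) (Fin m) Bool) _ _ fun x => rfl

/-- The weight of the inputs on which a tree succeeds at list decoding. -/
noncomputable def listVal (t : DTree (Fin n × Fin m) (Finset (Fin n → Bool)))
    (w : Fin n → (Fin m → Bool) → ℝ) : ℝ :=
  ∑ x, (∏ i, w i (block x i)) * if fpow f x ∈ t.out x then 1 else 0

lemma listVal_leaf (S : Finset (Fin n → Bool)) (w : Fin n → (Fin m → Bool) → ℝ) :
    listVal f (.leaf S) w = ∑ z ∈ S, ∏ i, classMass f (w i) (z i) := by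
  have : ∀ z : Fin n → Bool, ∏ i, classMass f (w i) (z i) =
      ∑ x : Fin n × Fin m → Bool, (∏ i, w i (block x i)) * if fpow f x = z then 1 else 0 := by
    intro z
    simp only [classMass]
    rw [← sum_prod_block fun i y => if f y = z i then w i y else 0]
    refine sum_congr rfl fun x _ => ?_
    by_cases h : fpow f x = z
    · rw [if_pos h, mul_one]
      exact prod_congr rfl fun i _ => if_pos (congrFun h i)
    · obtain ⟨i, hi⟩ := Function.ne_iff.1 h
      rw [if_neg h, mul_zero]
      exact prod_eq_zero (mem_univ i) (if_neg hi)
  simp only [this, listVal, DTree.out]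
  rw [sum_comm]
  exact sum_congr rfl fun x _ => by
    rw [← mul_sum, sum_ite_eq]
    by_cases h : fpow f x ∈ S <;> simp [h]

lemma prod_update_bitWeight (w : Fin n → (Fin m → Bool) → ℝ) (i : Fin n) (j : Fin m) (b : Bool)
    (x : Fin n × Fin m → Bool) :
    ∏ k, Function.update w i (bitWeight (w i) j b) k (block x k) =
      if x (i, j) = b then ∏ k, w k (block x k) else 0 := by
  by_cases h : x (i, j) = b
  · rw [if_pos h]
    refine prod_congr rfl fun k _ => ?_
    by_cases hk : k = i
    · subst hk; simp [bitWeight, block, h]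
    · rw [Function.update_of_ne hk]
  · rw [if_neg h]
    exact prod_eq_zero (mem_univ i) (by simp [bitWeight, block, h])

lemma listVal_node (i : Fin n) (j : Fin m) (t0 t1 : DTree (Fin n × Fin m) (Finset (Fin n → Bool)))
    (w : Fin n → (Fin m → Bool) → ℝ) :
    listVal f (.node (i, j) t0 t1) w =
      listVal f t0 (Function.update w i (bitWeight (w i) j false)) +
      listVal f t1 (Function.update w i (bitWeight (w i) j true)) := by
  simp only [listVal, prod_update_bitWeight, DTree.out]
  rw [← sum_add_distrib]
  exact sum_congr rfl fun x _ => by by_cases h : x (i, j) <;> simp [h]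

lemma sum_prod_classMass_le {ℓ : ℕ} (hℓ : ℓ ≤ n) {S : Finset (Fin n → Bool)}
    (hS : S.card = 2 ^ (n - ℓ)) (w : Fin n → (Fin m → Bool) → ℝ) :
    ∑ z ∈ S, ∏ i, classMass f (w i) (z i) ≤ √(1 / 2) ^ ℓ * ∏ i, leafVal f (w i) := by
  have hnn : 0 ≤ √(1 / 2) ^ ℓ * ∏ i, leafVal f (w i) :=
    mul_nonneg (by positivity) (prod_nonneg fun i _ => Real.sqrt_nonneg _)
  refine le_of_sq_le_sq ?_ hnn
  have hsq : ∀ i, leafVal f (w i) ^ 2 =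
      2 * ∑ b, classMass f (w i) b ^ 2 := by
    intro i
    rw [leafVal, Real.sq_sqrt (by positivity), Fintype.sum_bool, add_comm (_ ^ 2)]
  calc (∑ z ∈ S, ∏ i, classMass f (w i) (z i)) ^ 2
      ≤ S.card * ∑ z ∈ S, (∏ i, classMass f (w i) (z i)) ^ 2 := sq_sum_le_card_mul_sum_sq
    _ ≤ S.card * ∑ z : Fin n → Bool, (∏ i, classMass f (w i) (z i)) ^ 2 := by
        gcongr
        exact subset_univ S
    _ = 2 ^ (n - ℓ) * ∏ i, ∑ b, classMass f (w i) b ^ 2 := by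
        rw [hS, Fintype.prod_sum]
        simp [prod_pow]
    _ = (√(1 / 2) ^ ℓ * ∏ i, leafVal f (w i)) ^ 2 := by
        rw [mul_pow, ← prod_pow, prod_congr rfl fun i _ => hsq i, prod_mul_distrib, prod_const,
          card_univ, Fintype.card_fin, ← pow_mul, mul_comm ℓ, pow_mul,
          Real.sq_sqrt (by norm_num), ← mul_assoc]
        congr 1
        obtain ⟨k, rfl⟩ := Nat.exists_eq_add_of_le hℓ
        rw [Nat.add_sub_cancel_left, pow_add, ← mul_assoc, ← mul_pow]
        norm_num

/-- Upper bound on the success weight of shallow list decoding trees. -/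
lemma listVal_le {ℓ : ℕ} (hℓ : ℓ ≤ n) {α : ℝ} (hα : 0 ≤ α)
    (t : DTree (Fin n × Fin m) (Finset (Fin n → Bool)))
    (ht : t.allLabels fun S => S.card = 2 ^ (n - ℓ))
    (w : Fin n → (Fin m → Bool) → ℝ) (hw : ∀ i x, 0 ≤ w i x) :
    listVal f t w ≤ Real.exp (α * t.depth) * (√(1 / 2) ^ ℓ * ∏ i, optVal f α (w i)) := by
  induction t generalizing w with
  | leaf S =>
    rw [listVal_leaf]
    refine (sum_prod_classMass_le f hℓ ht w).trans ?_
    simp only [DTree.depth, Nat.cast_zero, mul_zero, Real.exp_zero, one_mul]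
    gcongr with i
    · exact fun i _ => Real.sqrt_nonneg _
    · exact leafVal_le_optVal f hα (hw i)
  | node ij t0 t1 h0 h1 =>
    obtain ⟨i, j⟩ := ij
    have hw' : ∀ b k x, 0 ≤ Function.update w i (bitWeight (w i) j b) k x := by
      intro b k x
      by_cases hk : k = i
      · subst hk; simpa using bitWeight_nonneg (hw k) j b x
      · simpa [Function.update_of_ne hk] using hw k x
    have hprod : ∀ b, ∏ k, optVal f α (Function.update w i (bitWeight (w i) j b) k) =
        optVal f α (bitWeight (w i) j b) * ∏ k ∈ univ.erase i, optVal f α (w k) := by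
      intro b
      rw [← mul_prod_erase univ _ (mem_univ i), Function.update_self]
      congr 1
      exact prod_congr rfl fun k hk => by rw [Function.update_of_ne (ne_of_mem_erase hk)]
    have hQ : 0 ≤ √(1 / 2) ^ ℓ * ∏ k ∈ univ.erase i, optVal f α (w k) :=
      mul_nonneg (by positivity) (prod_nonneg fun k _ => optVal_nonneg f hα (hw k))
    have hd : ∀ b, ∀ e : ℕ, e ≤ max t0.depth t1.depth →
        Real.exp (α * e) *
          (√(1 / 2) ^ ℓ * ∏ k, optVal f α (Function.update w i (bitWeight (w i) j b) k)) ≤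
        Real.exp (α * (max t0.depth t1.depth : ℕ)) *
          (√(1 / 2) ^ ℓ * ∏ k, optVal f α (Function.update w i (bitWeight (w i) j b) k)) := by
      intro b e he
      gcongr
      exact mul_nonneg (by positivity) (prod_nonneg fun k _ => optVal_nonneg f hα (hw' b k))
    have e0 := (h0 ht.1 _ (hw' false)).trans (hd false _ (le_max_left _ _))
    have e1 := (h1 ht.2 _ (hw' true)).trans (hd true _ (le_max_right _ _))
    rw [hprod] at e0 e1
    have hs := mul_le_mul_of_nonneg_left (optVal_add_le f hα (hw i) j)
      (mul_nonneg (Real.exp_nonneg (α * (max t0.depth t1.depth : ℕ))) hQ)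
    rw [listVal_node, DTree.depth, ← mul_prod_erase univ _ (mem_univ i), Nat.cast_succ, mul_add,
      Real.exp_add, mul_one]
    linarith

end DirectProduct

section Minimax

/-- Minimax principle: if every distribution on `X` admits an expected payoff below `1`, then some
finite mixture has payoff below `1` at every point of `X`. -/
lemma exists_mixture_lt_one {Ω T : Type} [Fintype Ω] [DecidableEq Ω] [Nonempty T]
    (v : T → Ω → ℝ) (X : Set Ω)
    (h : ∀ μ : Ω → ℝ, (∀ x, 0 ≤ μ x) → ∑ x, μ x = 1 → (∀ x ∉ X, μ x = 0) →
      ∃ t, ∑ x, μ x * v t x < 1) :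
    ∃ (J : Type) (_ : Fintype J) (p : J → ℝ) (z : J → T), (∀ j, 0 ≤ p j) ∧ ∑ j, p j = 1 ∧
      ∀ x ∈ X, ∑ j, p j * v (z j) x < 1 := by
  set O : Set (Ω → ℝ) := {u | ∀ x ∈ X, u x < 1} with hO
  have hOpi : O = X.pi fun _ => Set.Iio 1 := by ext u; simp [hO, Set.mem_pi]
  by_cases hdisj : Disjoint O (convexHull ℝ (Set.range v))
  · exfalso
    obtain ⟨F, s, hFO, hFC⟩ := geometric_hahn_banach_open
      (by rw [hOpi]; exact convex_pi fun _ _ => convex_Iio 1)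
      (by rw [hOpi]; exact isOpen_set_pi X.toFinite fun _ _ => isOpen_Iio)
      (convex_convexHull ℝ _) hdisj
    set μ : Ω → ℝ := fun x => F (Pi.single x 1) with hμ
    have hF : ∀ u, F u = ∑ x, μ x * u x := by
      intro u
      conv_lhs => rw [← univ_sum_single u]
      rw [map_sum]
      refine sum_congr rfl fun x _ => ?_
      rw [hμ, mul_comm, ← smul_eq_mul, ← map_smul, ← Pi.single_smul, smul_eq_mul, mul_one]
    have hFs : ∀ x (a : ℝ), F (Pi.single x a) = a * μ x := by
      intro x a
      rw [hμ, ← smul_eq_mul, ← map_smul, ← Pi.single_smul, smul_eq_mul, mul_one]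
    have hs : 0 < s := by simpa using hFO 0 (by simp [hO])
    have hμ0 : ∀ x, 0 ≤ μ x := by
      intro x
      by_contra! hneg
      have := hFO (Pi.single x (s / μ x)) fun y _ => by
        by_cases hy : y = x
        · subst hy
          simpa using (div_neg_of_pos_of_neg hs hneg).trans one_pos
        · simp [Pi.single_eq_of_ne hy]
      rw [hFs, div_mul_cancel₀ _ hneg.ne] at this
      exact lt_irrefl _ this
    have hμX : ∀ x ∉ X, μ x = 0 := by
      intro x hx
      by_contra hne
      have := hFO (Pi.single x (s / μ x)) fun y hy => by
        have hyx : y ≠ x := fun e => hx (e ▸ hy)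
        simp [Pi.single_eq_of_ne hyx]
      rw [hFs, div_mul_cancel₀ _ hne] at this
      exact lt_irrefl _ this
    have hle : ∑ x, μ x ≤ s := by
      refine le_of_forall_lt_imp_le_of_dense ?_
      intro a ha
      by_cases ha0 : a ≤ 0
      · exact ha0.trans hs.le
      push Not at ha0
      have hpos : 0 < ∑ x, μ x := ha0.trans ha
      have := hFO (fun _ => a / ∑ x, μ x) fun y _ => (div_lt_one hpos).2 ha
      rw [hF, ← sum_mul, mul_div_cancel₀ _ hpos.ne'] at this
      exact this.le
    have hpos : 0 < ∑ x, μ x := by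
      refine (sum_nonneg fun x _ => hμ0 x).lt_of_ne fun e => ?_
      have hz := (sum_eq_zero_iff_of_nonneg fun x _ => hμ0 x).1 e.symm
      obtain ⟨t⟩ := ‹Nonempty T›
      have := hFC (v t) (subset_convexHull ℝ _ ⟨t, rfl⟩)
      rw [hF, sum_eq_zero fun x hx => by rw [hz x hx, zero_mul]] at this
      linarith
    obtain ⟨t, ht⟩ := h (fun x => μ x / ∑ x, μ x) (fun x => div_nonneg (hμ0 x) hpos.le)
      (by rw [← sum_div, div_self hpos.ne']) fun x hx => by rw [hμX x hx, zero_div]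
    have h1 := hFC (v t) (subset_convexHull ℝ _ ⟨t, rfl⟩)
    rw [hF] at h1
    simp only [div_mul_eq_mul_div, ← sum_div] at ht
    rw [div_lt_one hpos] at ht
    linarith
  · obtain ⟨u, huO, huC⟩ := Set.not_disjoint_iff.1 hdisj
    obtain ⟨J, _, p, y, hp, hsum, hy, rfl⟩ := mem_convexHull_iff_exists_fintype.1 huC
    choose z hz using hy
    refine ⟨J, inferInstance, p, z, hp, hsum, fun x hx => ?_⟩
    simpa [hz, Finset.sum_apply] using huO x hx

end Minimax

section Forecast

variable {ι : Type} [Fintype ι] [DecidableEq ι] (f : (ι → Bool) → Bool)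

/-- The sign with which a log-odds forecast is penalised on the input `x`. -/
def lossSign (x : ι → Bool) : ℝ := if f x then -1 else 1

lemma sum_mul_exp_lossSign (w : (ι → Bool) → ℝ) (r : ℝ) :
    ∑ x, w x * Real.exp (lossSign f x * r) =
      classMass f w false * Real.exp r + classMass f w true * Real.exp (-r) := by
  rw [classMass, classMass, sum_mul, sum_mul, ← sum_add_distrib]
  exact sum_congr rfl fun x _ => by by_cases h : f x <;> simp [lossSign, h]

lemma exists_exp_balance {a b : ℝ} (ha : 0 ≤ a) (hb : 0 ≤ b) {ε : ℝ} (hε : 0 < ε) :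
    ∃ r : ℝ, a * Real.exp r + b * Real.exp (-r) ≤ 2 * (√a * √b) + ε := by
  set δ := ε / (√a + √b + 1) with hδ
  have hS : 0 < √a + √b + 1 := by positivity
  have hδ0 : 0 < δ := by positivity
  have h1 : ∀ c e : ℝ, 0 ≤ c → 0 ≤ e → c * (e / (√c + δ)) ≤ √c * e := by
    intro c e hc he
    have hp : 0 < √c + δ := by positivity
    rw [mul_div_assoc', div_le_iff₀ hp]
    nlinarith [Real.mul_self_sqrt hc, mul_nonneg (mul_nonneg (Real.sqrt_nonneg c) he) hδ0.le]
  refine ⟨Real.log ((√b + δ) / (√a + δ)), ?_⟩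
  rw [Real.exp_neg, Real.exp_log (by positivity), inv_div]
  have ea := h1 a (√b + δ) ha (by positivity)
  have eb := h1 b (√a + δ) hb (by positivity)
  have : δ * (√a + √b + 1) = ε := div_mul_cancel₀ _ hS.ne'
  nlinarith

lemma exp_quarter_le {s : ℝ} (h0 : 0 ≤ s) (h1 : s ≤ 1) : Real.exp (s / 4) ≤ 1 + s / 3 := by
  have h := Real.one_sub_le_exp_neg (s / 4)
  rw [Real.exp_neg] at h
  have hp : 0 < 1 - s / 4 := by linarith
  have := (le_inv_comm₀ hp (Real.exp_pos _)).1 h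
  refine this.trans ?_
  rw [inv_le_iff_one_le_mul₀ hp]
  nlinarith

lemma exp_neg_le {s : ℝ} (h0 : 0 ≤ s) (h1 : s ≤ 1) : Real.exp (-s) ≤ 1 - s / 2 := by
  rw [Real.exp_neg, inv_le_iff_one_le_mul₀ (Real.exp_pos _)]
  have := Real.add_one_le_exp s
  nlinarith

lemma hellinger_add_leafVal_le {a b s : ℝ} (ha : 0 ≤ a) (hb : 0 ≤ b) (h0 : 0 ≤ s) (h1 : s ≤ 1) :
    Real.exp (s / 4) * (2 * (√a * √b)) + Real.exp (-s) * √(2 * (a ^ 2 + b ^ 2)) ≤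
      2 * (a + b) := by
  set h := 2 * (√a * √b) with hh
  set φ := √(2 * (a ^ 2 + b ^ 2)) with hφ
  have hφ2 : φ ^ 2 = 2 * (a ^ 2 + b ^ 2) := Real.sq_sqrt (by positivity)
  have hh2 : h ^ 2 = 4 * (a * b) := by
    rw [hh, mul_pow, mul_pow, Real.sq_sqrt ha, Real.sq_sqrt hb]; norm_num
  have hφ0 : 0 ≤ φ := Real.sqrt_nonneg _
  have hh0 : 0 ≤ h := by positivity
  have e1 : a + b ≤ φ := Real.le_sqrt_of_sq_le (by nlinarith [sq_nonneg (a - b)])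
  have e2 : h ≤ a + b := abs_le_of_sq_le_sq' (by nlinarith [sq_nonneg (a - b)])
    (by positivity) |>.2
  have e3 : h + φ ≤ 2 * (a + b) := abs_le_of_sq_le_sq' (by nlinarith [sq_nonneg (h - φ)])
    (by positivity) |>.2
  have f1 := mul_le_mul_of_nonneg_right (exp_quarter_le h0 h1) hh0
  have f2 := mul_le_mul_of_nonneg_right (exp_neg_le h0 h1) hφ0
  nlinarith

/-- A tree with large discounted score yields a shallow forecasting tree with small loss. -/
lemma exists_forecast {α : ℝ} (hα : 0 ≤ α) {D : ℕ} (hD : α * D ≤ 1) (hD' : 1 ≤ α * (D + 1))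
    (t : DTree ι Unit) (c d : ℕ) (hcd : c + d = D) (w : (ι → Bool) → ℝ) (hw : ∀ x, 0 ≤ w x)
    {ε : ℝ} (hε : 0 < ε) :
    ∃ t' : DTree ι ℝ, t'.depth ≤ d ∧
      ∑ x, w x * Real.exp (lossSign f x * t'.out x + α / 4 * (c + t'.cost x : ℝ)) ≤
        ε + 2 * ∑ x, w x - Real.exp (-(α * c)) * treeVal f α t w := by
  have hleaf : ∀ (w : (ι → Bool) → ℝ) (c : ℕ) (r : ℝ),
      ∑ x, w x * Real.exp (lossSign f x * (DTree.leaf (ι := ι) r).out x +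
        α / 4 * (c + (DTree.leaf (ι := ι) r).cost x : ℝ)) =
      Real.exp (α * c / 4) * ∑ x, w x * Real.exp (lossSign f x * r) := by
    intro w c r
    rw [mul_sum]
    refine sum_congr rfl fun x _ => ?_
    simp only [DTree.out, DTree.cost, Nat.cast_zero, add_zero]
    rw [Real.exp_add]
    ring_nf
  induction t generalizing c d w ε with
  | leaf =>
    have hc : α * c ≤ 1 := le_trans (by gcongr; omega) hD
    have hc0 : 0 ≤ α * c := by positivity
    have ha := classMass_nonneg f hw false
    have hb := classMass_nonneg f hw true
    obtain ⟨r, hr⟩ := exists_exp_balance ha hb (half_pos hε)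
    refine ⟨.leaf r, Nat.zero_le _, ?_⟩
    rw [hleaf, sum_mul_exp_lossSign, ← classMass_add f w, treeVal, leafVal]
    have := hellinger_add_leafVal_le ha hb hc0 hc
    have h2 := mul_le_mul_of_nonneg_left hr (Real.exp_nonneg (α * c / 4))
    have h3 := mul_le_mul_of_nonneg_right (exp_quarter_le hc0 hc) (half_pos hε).le
    have h4 := mul_le_mul_of_nonneg_right hc hε.le
    linarith
  | node i t0 t1 h0 h1 =>
    rcases Nat.eq_zero_or_pos d with rfl | hd
    · have hW : 0 ≤ ∑ x, w x := sum_nonneg fun x _ => hw x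
      have hcD : c = D := by omega
      have hq := exp_quarter_le (s := α * c) (by positivity) (by rw [hcD]; exact hD)
      refine ⟨.leaf 0, le_rfl, ?_⟩
      rw [hleaf]
      simp only [mul_zero, Real.exp_zero, mul_one]
      have h2 := mul_le_mul_of_nonneg_left (treeVal_node_le f hα i t0 t1 hw)
        (Real.exp_nonneg (-(α * c)))
      rw [← mul_assoc, ← Real.exp_add] at h2
      have h3 : Real.exp (-(α * c) + -α) ≤ Real.exp (-1) := by
        rw [Real.exp_le_exp, hcD]; linarith
      have h4 : Real.exp (-1) ≤ 2 / 5 := Real.exp_neg_one_lt_d9.le.trans (by norm_num)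
      have h5 : √2 ≤ 3 / 2 := Real.sqrt_le_iff.2 ⟨by norm_num, by norm_num⟩
      have h6 : Real.exp (-(α * c) + -α) * (√2 * ∑ x, w x) ≤ 2 / 5 * (3 / 2 * ∑ x, w x) := by
        gcongr
        exact h3.trans h4
      have h7 := mul_le_mul_of_nonneg_right hq hW
      have h8 : α * c * ∑ x, w x ≤ 1 * ∑ x, w x := by
        gcongr
        rw [hcD]; exact hD
      nlinarith
    · obtain ⟨s0, hs0, e0⟩ := h0 (c + 1) (d - 1) (by omega) _ (bitWeight_nonneg hw i false)
        (half_pos hε)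
      obtain ⟨s1, hs1, e1⟩ := h1 (c + 1) (d - 1) (by omega) _ (bitWeight_nonneg hw i true)
        (half_pos hε)
      refine ⟨.node i s0 s1, by simp only [DTree.depth]; omega, ?_⟩
      have hsplit : ∀ x, Real.exp (lossSign f x * (DTree.node i s0 s1).out x +
          α / 4 * (c + (DTree.node i s0 s1).cost x : ℝ)) =
          if x i then Real.exp (lossSign f x * s1.out x + α / 4 * ((c + 1 : ℕ) + s1.cost x : ℝ))
          else Real.exp (lossSign f x * s0.out x + α / 4 * ((c + 1 : ℕ) + s0.cost x : ℝ)) := by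
        intro x
        simp only [DTree.out, DTree.cost]
        by_cases h : x i
        · simp only [h, if_true]; push_cast; ring_nf
        · simp only [h]; push_cast; ring_nf
      simp only [hsplit, sum_node]
      rw [treeVal, ← sum_bitWeight w i, ← mul_assoc, ← Real.exp_add]
      have hexp : -(α * c) + -α = -(α * ((c + 1 : ℕ) : ℝ)) := by push_cast; ring
      rw [hexp]
      linarith

end Forecast

section Amplification

variable {ι : Type}

/-- Repeating a forecasting algorithm with exponentially discounted loss at most `ρ`, and adding up
the forecasts until about `B` queries have been made, makes the loss exponentially small. -/
lemma exists_repeat {J : Type} [Fintype J] (p : J → ℝ) (z : J → DTree ι ℝ)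
    (hp : ∀ j, 0 ≤ p j) (hp1 : ∑ j, p j = 1) (d : ℕ) (hz : ∀ j, (z j).depth ≤ d)
    (X : Set (ι → Bool)) (σ : (ι → Bool) → ℝ) {β ρ : ℝ} (hβ : 0 ≤ β) (hρ0 : 0 ≤ ρ) (hρ1 : ρ ≤ 1)
    (h : ∀ x ∈ X, ∑ j, p j * Real.exp (σ x * (z j).out x + β * (z j).cost x) ≤ ρ) (N : ℕ) :
    ∃ (K : Type) (_ : Fintype K) (q : K → ℝ) (T : K → ℝ → ℕ → DTree ι ℝ),
      (∀ k, 0 ≤ q k) ∧ ∑ k, q k = 1 ∧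
      (∀ k r B, 1 ≤ B → (T k r B).depth + 1 ≤ B + d) ∧
      ∀ x ∈ X, ∀ r B, 1 ≤ B → ∑ k, q k * Real.exp (σ x * (T k r B).out x) ≤
        Real.exp (σ x * r) * (Real.exp (-(β * B)) + ρ ^ N) := by
  induction N with
  | zero =>
    refine ⟨Unit, inferInstance, fun _ => 1, fun _ r _ => .leaf r, by simp, by simp, ?_, ?_⟩
    · intro _ r B hB
      simp only [DTree.depth]; omega
    · intro x _ r B _
      simp only [DTree.out, univ_unique, sum_const, card_singleton, one_smul, one_mul, pow_zero]
      refine le_mul_of_one_le_right (Real.exp_nonneg _) ?_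
      linarith [Real.exp_nonneg (-(β * B))]
  | succ N ih =>
    obtain ⟨K, _, q, T, hq, hq1, hT, hE⟩ := ih
    refine ⟨J × K, inferInstance, fun jk => p jk.1 * q jk.2, fun jk r B =>
      (z jk.1).graft (fun r' c => if B ≤ c then .leaf (r + r') else T jk.2 (r + r') (B - c)) 0,
      fun jk => mul_nonneg (hp _) (hq _), ?_, ?_, ?_⟩
    · rw [Fintype.sum_prod_type]
      simp only [← mul_sum, hq1, mul_one, hp1]
    · rintro ⟨j, k⟩ r B hB
      have hzj := hz j
      have := DTree.depth_graft_le
        (fun r' c => if B ≤ c then .leaf (r + r') else T k (r + r') (B - c)) (B + d - 1) (z j) 0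
        fun lab e he => by
          split
          · simp only [DTree.depth]; omega
          · have := hT k (r + lab) (B - e) (by omega)
            omega
      dsimp only
      omega
    · intro x hx r B hB
      rw [Fintype.sum_prod_type]
      have hstep : ∀ j, ∑ k, p j * q k * Real.exp (σ x * ((z j).graft
          (fun r' c => if B ≤ c then .leaf (r + r') else T k (r + r') (B - c)) 0).out x) ≤
          p j * Real.exp (σ x * (z j).out x + β * (z j).cost x) *
            (Real.exp (σ x * r) * (Real.exp (-(β * B)) + ρ ^ N)) := by
        intro j
        simp only [mul_assoc (p j), ← mul_sum]
        refine mul_le_mul_of_nonneg_left ?_ (hp j)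
        simp only [DTree.out_graft, zero_add]
        set u := (z j).out x
        set c := (z j).cost x
        by_cases hc : B ≤ c
        · simp only [hc, if_true, DTree.out, ← sum_mul, hq1, one_mul]
          calc Real.exp (σ x * (r + u))
              ≤ Real.exp (σ x * u + β * c + (σ x * r + -(β * B))) := by
                rw [Real.exp_le_exp]
                have : β * B ≤ β * c := by gcongr
                linarith
            _ = Real.exp (σ x * u + β * c) * (Real.exp (σ x * r) * Real.exp (-(β * B))) := by
                rw [Real.exp_add, Real.exp_add (σ x * r)]
            _ ≤ _ := by
                gcongr
                exact le_add_of_nonneg_right (by positivity)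
        · simp only [hc, if_false]
          refine (hE x hx (r + u) (B - c) (by omega)).trans ?_
          rw [Nat.cast_sub (by omega : c ≤ B), ← mul_assoc, ← Real.exp_add, mul_add, mul_add,
            ← Real.exp_add, mul_add (Real.exp _), ← Real.exp_add]
          have hβc : 0 ≤ β * c := by positivity
          gcongr ?_ + ?_ * _
          · exact Real.exp_le_exp.2 (by linarith)
          · exact Real.exp_le_exp.2 (by linarith)
      refine (sum_le_sum fun j _ => hstep j).trans ?_
      rw [← sum_mul, mul_left_comm]
      refine mul_le_mul_of_nonneg_left ?_ (Real.exp_nonneg _)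
      have hb := Real.exp_nonneg (-(β * B))
      calc _ ≤ ρ * (Real.exp (-(β * B)) + ρ ^ N) := by gcongr; exact h x hx
        _ ≤ Real.exp (-(β * B)) + ρ ^ (N + 1) := by
            rw [mul_add, pow_succ']
            gcongr
            exact mul_le_of_le_one_left hb hρ1

end Amplification

section WorstCase

lemma Rwc_le {ι : Type} (X : Set (ι → Bool)) (f : (ι → Bool) → Bool) {D : ℕ} {K : Type} [Fintype K]
    (q : K → ℝ) (T : K → DTree ι ℝ) (hq : ∀ k, 0 ≤ q k) (hq1 : ∑ k, q k = 1)
    (hT : ∀ k, (T k).depth ≤ D)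
    (h : ∀ x ∈ X, ∑ k, q k * Real.exp (lossSign f x * (T k).out x) ≤ 1 / 3) :
    Rwc X f (2 / 3) ≤ D := by
  classical
  let e := Fintype.equivFin K
  refine Nat.sInf_le ⟨⟨Fintype.card K, fun j => q (e.symm j),
    fun j => (T (e.symm j)).map fun r => decide (0 ≤ r), fun j => hq _, ?_⟩, ?_, ?_, ?_⟩
  · rw [← hq1]; exact e.symm.sum_comp q
  · exact fun j _ => DTree.allLabels_true _
  · intro x hx
    simp only [DTree.out_map]
    rw [e.symm.sum_comp fun k => if decide (0 ≤ (T k).out x) = f x then q k else 0]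
    have : ∀ k, q k - q k * Real.exp (lossSign f x * (T k).out x) ≤
        if decide (0 ≤ (T k).out x) = f x then q k else 0 := by
      intro k
      split
      · have := mul_nonneg (hq k) (Real.exp_nonneg (lossSign f x * (T k).out x))
        linarith
      · rename_i hne
        have h1 : 1 ≤ Real.exp (lossSign f x * (T k).out x) := by
          rw [Real.one_le_exp_iff]
          by_cases hf : f x
          · have : (T k).out x < 0 := by simpa [hf] using hne
            simp only [lossSign, hf, if_true]; linarith
          · have : 0 ≤ (T k).out x := by simpa [hf] using hne
            simpa [lossSign, hf] using this
        linarith [le_mul_of_one_le_right (hq k) h1]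
    refine le_trans ?_ (sum_le_sum fun k _ => this k)
    rw [sum_sub_distrib, hq1]
    linarith [h x hx]
  · intro j _
    rw [DTree.depth_map]
    exact hT _

/-- A hard distribution: one for which no tree beats the trivial discounted score. -/
lemma exists_hard_distribution {m : ℕ} (X : Set (Fin m → Bool)) (f : (Fin m → Bool) → Bool)
    (hR : 1 ≤ Rwc X f (2 / 3)) :
    ∃ μ : (Fin m → Bool) → ℝ, (∀ x, 0 ≤ μ x) ∧ ∑ x, μ x = 1 ∧ (∀ x ∉ X, μ x = 0) ∧
      optVal f (16 / (Rwc X f (2 / 3) : ℝ)) μ ≤ 1 := by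
  classical
  set R := Rwc X f (2 / 3) with hRdef
  have hR0 : (0 : ℝ) < R := by exact_mod_cast hR
  set α : ℝ := 16 / R with hαdef
  have hα : 0 ≤ α := by positivity
  have hαR : α * R = 16 := div_mul_cancel₀ _ hR0.ne'
  by_contra! hcon
  set d := R / 16 with hd
  have hd1 : α * d ≤ 1 := by
    have h16 : 16 * (d : ℝ) ≤ R := by exact_mod_cast Nat.mul_div_le R 16
    have := mul_le_mul_of_nonneg_left h16 hα
    linarith
  have hd2 : 1 ≤ α * (d + 1) := by
    have h16 : (R : ℝ) ≤ 16 * (d + 1) := by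
      exact_mod_cast (show R ≤ 16 * (d + 1) by omega)
    have := mul_le_mul_of_nonneg_left h16 hα
    linarith
  have : Nonempty {t : DTree (Fin m) ℝ // t.depth ≤ d} := ⟨⟨.leaf 0, Nat.zero_le _⟩⟩
  obtain ⟨J, _, p, z, hp, hp1, hlt⟩ := exists_mixture_lt_one
    (fun (t : {t : DTree (Fin m) ℝ // t.depth ≤ d}) x =>
      Real.exp (lossSign f x * t.1.out x + α / 4 * t.1.cost x)) X fun μ hμ hμ1 hμX => by
    have : Nonempty (DTree (Fin m) Unit) := ⟨.leaf ()⟩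
    obtain ⟨t, ht⟩ := exists_lt_of_lt_ciSup (hcon μ hμ hμ1 hμX)
    obtain ⟨t', ht', hl⟩ := exists_forecast f hα hd1 hd2 t 0 d (zero_add d) μ hμ
      (ε := (treeVal f α t μ - 1) / 2) (by linarith)
    refine ⟨⟨t', ht'⟩, lt_of_le_of_lt ?_ (show 1 - (treeVal f α t μ - 1) / 2 < 1 by linarith)⟩
    simp only [Nat.cast_zero, zero_add, mul_zero, neg_zero, Real.exp_zero, one_mul, hμ1] at hl
    linarith
  obtain ⟨ρ, hρ0, hρ1, hρ⟩ : ∃ ρ : ℝ, 0 ≤ ρ ∧ ρ < 1 ∧ ∀ x ∈ X,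
      ∑ j, p j * Real.exp (lossSign f x * (z j).1.out x + α / 4 * (z j).1.cost x) ≤ ρ := by
    set g : (Fin m → Bool) → ℝ := fun x => if x ∈ X then
      ∑ j, p j * Real.exp (lossSign f x * (z j).1.out x + α / 4 * (z j).1.cost x) else 0 with hg
    obtain ⟨x, -, hx⟩ := exists_max_image univ g univ_nonempty
    refine ⟨g x, ?_, ?_, fun y hy => ?_⟩
    · simp only [hg]
      split
      · exact sum_nonneg fun j _ => mul_nonneg (hp j) (Real.exp_nonneg _)
      · exact le_rfl
    · simp only [hg]
      split
      · exact hlt x ‹_›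
      · exact one_pos
    · have := hx y (mem_univ y)
      simpa only [hg, if_pos hy] using this
  obtain ⟨N, hN⟩ := exists_pow_lt_of_lt_one (show (0 : ℝ) < 1 / 12 by norm_num) hρ1
  obtain ⟨K, _, q, T, hq, hq1, hT, hE⟩ := exists_repeat p (fun j => (z j).1) hp hp1 d
    (fun j => (z j).2) X (lossSign f) (by positivity : 0 ≤ α / 4) hρ0 hρ1.le hρ N
  set B := (R + 1) / 2 with hB
  have hB1 : 1 ≤ B := by omega
  have hαB : 2 ≤ α / 4 * B := by
    have h2 : (R : ℝ) ≤ 2 * B := by exact_mod_cast (show R ≤ 2 * B by omega)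
    have := mul_le_mul_of_nonneg_left h2 hα
    linarith
  have hexp : Real.exp (-(α / 4 * B)) ≤ 1 / 4 := by
    calc Real.exp (-(α / 4 * B)) ≤ Real.exp (-1 + -1) := Real.exp_le_exp.2 (by linarith)
      _ ≤ 1 / 2 * (1 / 2) := by
          rw [Real.exp_add]
          have : Real.exp (-1) ≤ 1 / 2 := Real.exp_neg_one_lt_d9.le.trans (by norm_num)
          gcongr
      _ = 1 / 4 := by norm_num
  have hle : R ≤ R - 1 := Rwc_le X f q (fun k => T k 0 B) hq hq1
    (fun k => by have := hT k 0 B hB1; omega) fun x hx => by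
      refine (hE x hx 0 B hB1).trans ?_
      rw [mul_zero, Real.exp_zero, one_mul]
      linarith
  omega

variable {m n : ℕ}

open Classical in
lemma RwcTask_spec {ι L : Type} (X : Set (ι → Bool)) (good : (ι → Bool) → L → Prop)
    (labelOK : L → Prop) {δ : ℝ} (hδ : δ ≤ 1) (t : DTree ι L) (ht : t.allLabels labelOK)
    (hgood : ∀ x ∈ X, good x (t.out x)) :
    ∃ R : RandAlg ι L, (∀ j, R.p j ≠ 0 → (R.T j).allLabels labelOK) ∧
      (∀ x ∈ X, δ ≤ ∑ j, if good x ((R.T j).out x) then R.p j else 0) ∧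
      ∀ j, R.p j ≠ 0 → (R.T j).depth ≤ RwcTask X good labelOK δ := by
  refine Nat.sInf_mem (s := {d : ℕ | ∃ R : RandAlg ι L,
    (∀ j, R.p j ≠ 0 → (R.T j).allLabels labelOK) ∧
    (∀ x ∈ X, δ ≤ ∑ j, if good x ((R.T j).out x) then R.p j else 0) ∧
    ∀ j, R.p j ≠ 0 → (R.T j).depth ≤ d})
    ⟨t.depth, ⟨1, fun _ => 1, fun _ => t, by simp, by simp⟩, fun _ _ => ht, fun x hx => ?_,
      fun _ _ => le_rfl⟩
  simpa [hgood x hx] using hδ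

lemma RwcLD_spec (X : Set (Fin m → Bool)) (f : (Fin m → Bool) → Bool) (ℓ : ℕ) {δ : ℝ}
    (hδ : δ ≤ 1) :
    ∃ R : RandAlg (Fin n × Fin m) (Finset (Fin n → Bool)),
      (∀ j, R.p j ≠ 0 → (R.T j).allLabels fun S => S.card = 2 ^ (n - ℓ)) ∧
      (∀ x ∈ Xpow n X, δ ≤ ∑ j, if fpow f x ∈ (R.T j).out x then R.p j else 0) ∧
      ∀ j, R.p j ≠ 0 → (R.T j).depth ≤ RwcLD X f n ℓ δ := by
  have hS : ∀ z : Fin n → Bool, ∃ S : Finset (Fin n → Bool), {z} ⊆ S ∧ S.card = 2 ^ (n - ℓ) :=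
    fun z => exists_superset_card_eq (by simpa using Nat.one_le_two_pow) (by
      simpa using Nat.pow_le_pow_right two_pos (Nat.sub_le n ℓ))
  choose S hzS hcard using hS
  obtain ⟨t, ht, hout⟩ := DTree.exists_out_eq (fun S : Finset (Fin n → Bool) => S.card = 2 ^ (n - ℓ))
    (fun x : Fin n × Fin m → Bool => S (fpow f x)) fun x => hcard _
  obtain ⟨R, h1, h2, h3⟩ := RwcTask_spec (Xpow n X) (fun x S => fpow f x ∈ S)
    (fun S : Finset (Fin n → Bool) => S.card = 2 ^ (n - ℓ)) hδ t ht fun x _ => by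
      rw [hout]; exact singleton_subset_iff.1 (hzS _)
  exact ⟨R, h1, fun x hx => (h2 x hx).trans_eq (sum_congr rfl fun j _ => by congr), h3⟩

/-- The success probability of a list decoding algorithm bounds its depth from below. -/
lemma le_exp_RwcLD (X : Set (Fin m → Bool)) (f : (Fin m → Bool) → Bool) {ℓ : ℕ} (hℓ : ℓ ≤ n)
    {δ : ℝ} (hδ : δ ≤ 1) {α : ℝ} (hα : 0 ≤ α) (μ : (Fin m → Bool) → ℝ) (hμ : ∀ x, 0 ≤ μ x)
    (hμ1 : ∑ x, μ x = 1) (hμX : ∀ x ∉ X, μ x = 0) (hopt : optVal f α μ ≤ 1) :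
    δ ≤ Real.exp (α * RwcLD X f n ℓ δ) * √(1 / 2) ^ ℓ := by
  obtain ⟨R, hlab, hsucc, hdepth⟩ := RwcLD_spec (n := n) X f ℓ hδ
  have hone : ∑ x : Fin n × Fin m → Bool, ∏ i, μ (block x i) = 1 := by
    rw [sum_prod_block fun _ => μ]
    simp [hμ1]
  calc δ = ∑ x : Fin n × Fin m → Bool, (∏ i, μ (block x i)) * δ := by rw [← sum_mul, hone, one_mul]
    _ ≤ ∑ x : Fin n × Fin m → Bool, (∏ i, μ (block x i)) *
          ∑ j, if fpow f x ∈ (R.T j).out x then R.p j else 0 := by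
        refine sum_le_sum fun x _ => ?_
        by_cases hx : x ∈ Xpow n X
        · exact mul_le_mul_of_nonneg_left (hsucc x hx) (prod_nonneg fun i _ => hμ _)
        · obtain ⟨i, hi⟩ := not_forall.1 hx
          rw [prod_eq_zero (mem_univ i) (hμX _ hi), zero_mul, zero_mul]
    _ = ∑ j, R.p j * listVal f (R.T j) fun _ => μ := by
        simp only [listVal, mul_sum]
        rw [sum_comm]
        refine sum_congr rfl fun j _ => sum_congr rfl fun x _ => ?_
        by_cases h : fpow f x ∈ (R.T j).out x <;> simp [h, mul_comm]
    _ ≤ ∑ j, R.p j * (Real.exp (α * RwcLD X f n ℓ δ) * √(1 / 2) ^ ℓ) := by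
        refine sum_le_sum fun j _ => ?_
        by_cases hj : R.p j = 0
        · simp [hj]
        refine mul_le_mul_of_nonneg_left ?_ (R.p_nonneg j)
        refine (listVal_le f hℓ hα (R.T j) (hlab j hj) _ fun _ => hμ).trans ?_
        have h0 := optVal_nonneg f hα hμ
        rw [prod_const]
        gcongr
        · exact hdepth j hj
        · exact mul_le_of_le_one_right (by positivity) (pow_le_one₀ h0 hopt)
    _ = _ := by rw [← sum_mul, R.p_sum, one_mul]

end WorstCase

/-- **List-decoding direct product theorem**: there exist universal constants `c ∈ (1/2,1)`
and `c' > 0` such that `R_{γ^ℓ}(LD_ℓⁿ ∘ f) ≥ c'·ℓ·R(f)` for all `γ ∈ [c,1)`. -/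
theorem list_decoding_direct_product_theorem :
    ∃ c c' : ℝ, 1 / 2 < c ∧ c < 1 ∧ 0 < c' ∧
      ∀ (m : ℕ) (X : Set (Fin m → Bool)) (f : (Fin m → Bool) → Bool) (n ℓ : ℕ),
        1 ≤ ℓ → ℓ ≤ n → ∀ γ : ℝ, c ≤ γ → γ < 1 →
        c' * ℓ * (Rwc X f (2 / 3) : ℝ) ≤ (RwcLD X f n ℓ (γ ^ ℓ) : ℝ) := by
  refine ⟨9 / 10, 1 / 100, by norm_num, by norm_num, by norm_num, ?_⟩
  intro m X f n ℓ hℓ1 hℓn γ hγ hγ1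
  rcases Nat.eq_zero_or_pos (Rwc X f (2 / 3)) with h0 | hR
  · rw [h0]; simp
  obtain ⟨μ, hμ, hμ1, hμX, hopt⟩ := exists_hard_distribution X f hR
  set R := Rwc X f (2 / 3)
  have hR0 : (0 : ℝ) < R := by exact_mod_cast hR
  have hγ0 : 0 ≤ γ := by linarith
  have hmain := le_exp_RwcLD X f hℓn (pow_le_one₀ (n := ℓ) hγ0 hγ1.le) (by positivity) μ hμ hμ1 hμX hopt
  set T : ℝ := (RwcLD X f n ℓ (γ ^ ℓ) : ℝ)
  have hs : √(1 / 2 : ℝ) ≤ 3 / 4 := Real.sqrt_le_iff.2 ⟨by norm_num, by norm_num⟩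
  have h1 : (9 / 10 : ℝ) ^ ℓ ≤ Real.exp (16 / R * T) * (3 / 4) ^ ℓ :=
    calc (9 / 10 : ℝ) ^ ℓ ≤ γ ^ ℓ := by gcongr
      _ ≤ _ := hmain
      _ ≤ _ := by gcongr
  have h2 : Real.exp (1 / 6 * ℓ) ≤ Real.exp (16 / R * T) :=
    calc Real.exp (1 / 6 * ℓ) = Real.exp (1 / 6) ^ ℓ := by rw [mul_comm, Real.exp_nat_mul]
      _ ≤ (6 / 5) ^ ℓ := by
          gcongr
          have h := Real.one_sub_le_exp_neg (1 / 6)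
          rw [Real.exp_neg, le_inv_comm₀ (by norm_num) (Real.exp_pos _)] at h
          exact h.trans (by norm_num)
      _ = (9 / 10) ^ ℓ / (3 / 4) ^ ℓ := by rw [← div_pow]; norm_num
      _ ≤ Real.exp (16 / R * T) := by rwa [div_le_iff₀ (by positivity)]
  have h3 := Real.exp_le_exp.1 h2
  rw [div_mul_eq_mul_div (16 : ℝ), le_div_iff₀ hR0] at h3
  have h4 : 0 ≤ (ℓ : ℝ) * R := by positivity
  linarith
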